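/- For every ρ ∈ M₂(ℂ), the map d_ρ : O → O defined by d_ρ(X,u,u*) := (ρX − Xρ, ρu, −u*∘ρ) is a derivation of the octonion model O. -/

import Mathlib

open Matrix

noncomputable section

/-- 2×2 complex matrices. -/
abbrev M2 : Type := Matrix (Fin 2) (Fin 2) ℂ
/-- ℂ². -/
abbrev V2 : Type := Fin 2 → ℂ
/-- The dual space (ℂ²)*. -/
abbrev Dual2 : Type := Module.Dual ℂ V2

/-- `X⁰ = (tr X)·I − X`. -/
def msharp (X : M2) : M2 := X.trace • (1 : M2) - X

/-- The rank-one matrix u ⊗ v* : w ↦ v*(w)·u. -/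
def rankOne (u : V2) (vs : Dual2) : M2 := vecMulVec u fun j => vs (Pi.single j 1)

/-- The underlying vector space of the octonion model: M₂(ℂ) × ℂ² × (ℂ²)*. -/
abbrev Ox : Type := M2 × V2 × Dual2

/-- Octonion multiplication:
(X,u,u*)·(Y,v,v*) = (XY − 2·u⊗v* − 2·(v⊗u*)⁰, X⁰v + Yu, v*∘X + u*∘Y⁰). -/
def mulO (p q : Ox) : Ox :=
  (p.1 * q.1 - (2 : ℂ) • rankOne p.2.1 q.2.2 - (2 : ℂ) • msharp (rankOne q.2.1 p.2.2),
   msharp p.1 *ᵥ q.2.1 + q.1 *ᵥ p.2.1,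
   q.2.2 ∘ₗ Matrix.mulVecLin p.1 + p.2.2 ∘ₗ Matrix.mulVecLin (msharp q.1))

/-- The octonion norm q(X,u,u*) = det X + 2·u*(u). -/
def qO (p : Ox) : ℂ := p.1.det + 2 * p.2.2 p.2.1

/-- The polar form of the octonion norm. -/
def bO (p q : Ox) : ℂ := qO (p + q) - qO p - qO q

/-- The unit (I,0,0) of the octonion model. -/
def oneO : Ox := (1, 0, 0)

/-- The map d_ρ : O → O, (X,u,u*) ↦ (ρX − Xρ, ρu, −u*∘ρ). -/
def dRho (ρ : M2) (p : Ox) : Ox :=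
  (ρ * p.1 - p.1 * ρ, ρ *ᵥ p.2.1, -(p.2.2 ∘ₗ Matrix.mulVecLin ρ))

theorem rankOne_mulVec (A : M2) (u : V2) (vs : Dual2) :
    rankOne (A *ᵥ u) vs = A * rankOne u vs := by
  rw [rankOne, rankOne, mul_vecMulVec]

theorem rankOne_comp_mulVecLin (A : M2) (u : V2) (vs : Dual2) :
    rankOne u (vs ∘ₗ A.mulVecLin) = rankOne u vs * A := by
  rw [rankOne, rankOne, vecMulVec_mul]
  congr 1
  ext j
  have h : A *ᵥ Pi.single j 1 = ∑ i, A i j • (Pi.single i 1 : V2) := by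
    rw [mulVec_single_one]
    exact pi_eq_sum_univ' (A.col j)
  simp [h, vecMul, dotProduct, mul_comm]

theorem rankOne_neg (u : V2) (vs : Dual2) : rankOne u (-vs) = -rankOne u vs := by
  ext i j
  simp [rankOne, vecMulVec_apply]

theorem msharp_commutator (A X : M2) : msharp (A * X - X * A) = -(A * X - X * A) := by
  simp [msharp, trace_mul_comm A X]

theorem commutator_msharp (A X : M2) :
    A * msharp X - msharp X * A = -(A * X - X * A) := by
  simp only [msharp, mul_sub, sub_mul, mul_smul_comm, smul_mul, mul_one, one_mul]
  abel

theorem msharp_sub (X Y : M2) : msharp (X - Y) = msharp X - msharp Y := by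
  simp only [msharp, trace_sub, sub_smul]
  abel

theorem msharp_neg (X : M2) : msharp (-X) = -msharp X := by
  simpa [msharp] using msharp_sub 0 X

/-- The commutator with `A` commutes with `X ↦ X⁰`. -/
theorem mul_msharp_sub_msharp_mul (A X : M2) :
    A * msharp X - msharp X * A = msharp (A * X) - msharp (X * A) := by
  rw [commutator_msharp, ← msharp_commutator, msharp_sub]

theorem dRho_add (ρ : M2) (p q : Ox) : dRho ρ (p + q) = dRho ρ p + dRho ρ q := by
  refine Prod.ext ?_ (Prod.ext ?_ ?_)
  · simp only [dRho, Prod.fst_add, mul_add, add_mul]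
    abel
  · simp [dRho, mulVec_add]
  · simp only [dRho, Prod.snd_add, LinearMap.add_comp]
    abel

theorem dRho_smul (ρ : M2) (c : ℂ) (p : Ox) : dRho ρ (c • p) = c • dRho ρ p := by
  refine Prod.ext ?_ (Prod.ext ?_ ?_)
  · simp [dRho, smul_sub]
  · simp [dRho, mulVec_smul]
  · simp [dRho, LinearMap.smul_comp]

theorem dRho_mulO (ρ : M2) (p q : Ox) :
    dRho ρ (mulO p q) = mulO (dRho ρ p) q + mulO p (dRho ρ q) := by
  obtain ⟨X, u, us⟩ := p
  obtain ⟨Y, v, vs⟩ := q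
  refine Prod.ext ?_ (Prod.ext ?_ ?_)
  · have h := mul_msharp_sub_msharp_mul ρ (rankOne v us)
    simp only [dRho, mulO, Prod.fst_add, rankOne_mulVec, rankOne_neg, rankOne_comp_mulVecLin,
      msharp_neg]
    rw [sub_eq_iff_eq_add] at h
    simp only [mul_sub, sub_mul, mul_smul_comm, smul_mul, h, mul_assoc]
    module
  · have h := commutator_msharp ρ X
    rw [sub_eq_iff_eq_add] at h
    simp only [dRho, mulO, Prod.snd_add, Prod.fst_add, msharp_commutator, mulVec_add,
      mulVec_mulVec, h, add_mulVec, sub_mulVec, neg_mulVec]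
    abel
  · have h := commutator_msharp ρ Y
    rw [sub_eq_iff_eq_add] at h
    refine LinearMap.ext fun w => ?_
    simp only [dRho, mulO, Prod.snd_add, msharp_commutator, LinearMap.add_apply,
      LinearMap.neg_apply, LinearMap.comp_apply, mulVecLin_apply, mulVec_mulVec, h]
    simp only [add_mulVec, sub_mulVec, neg_mulVec, map_add, map_sub, map_neg]
    abel

/-- for every ρ ∈ M₂(ℂ), the map d_ρ(X,u,u*) = (ρX−Xρ, ρu, −u*∘ρ) is a
derivation of the octonion model O. -/
theorem dRho_is_derivation (ρ : M2) :
    (∀ p q : Ox, dRho ρ (p + q) = dRho ρ p + dRho ρ q) ∧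
    (∀ (c : ℂ) (p : Ox), dRho ρ (c • p) = c • dRho ρ p) ∧
    (∀ p q : Ox, dRho ρ (mulO p q) = mulO (dRho ρ p) q + mulO p (dRho ρ q)) :=
  ⟨dRho_add ρ, dRho_smul ρ, dRho_mulO ρ⟩

end
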